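/- arXiv:1611.09376 — 3 statements merged into one kernel-verified Lean document; each statement's English description precedes it below -/
import Mathlib

section
/- Let ω ∈ ⋀^k Ω satisfy the invariance condition ω ∧ df_i ∈ I·⋀^{k+1}Ω for every i = 1,…,k. For any family of polynomials (λ_K)_K ∈ R indexed by the strictly increasing multi-indices K of length k in {1,…,n}, set g := Σ_K λ_K·Δ_K and ξ := Σ_K λ_K·a_K. Then g·ω − ξ·(df_1 ∧ ⋯ ∧ df_k) ∈ I·⋀^k Ω. (This is the algebraic, polynomial-coefficient form of the Aleksandrov–Saito decomposition g·ω = df_1∧⋯∧df_k·ξ + η with η ∈ (f_1,…,f_k)·⋀^kΩ, where g lies in the ideal generated by the maximal Jacobian minors and ξ = Σ λ_K a_K.) -/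
open ExteriorAlgebra

set_option synthInstance.maxHeartbeats 1000000
set_option maxHeartbeats 1000000

noncomputable instance (k n : ℕ) : DecidablePred (fun J : Fin k → Fin n => StrictMono J) :=
  fun _ => Classical.dec _

section Contraction

open CliffordAlgebra (contractRight contractRight_mul_ι)

variable {R M : Type*} [CommRing R] [AddCommGroup M] [Module R M]

/-- Contraction from the right by the covectors `X (m - 1), …, X 0`, in this order. -/
noncomputable def iteratedContract :
    (m : ℕ) → (Fin m → Module.Dual R M) → ExteriorAlgebra R M →ₗ[R] ExteriorAlgebra R M
  | 0, _ => LinearMap.id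
  | m + 1, X => (contractRight (Q := (0 : QuadraticForm R M))).flip (X 0) ∘ₗ
      iteratedContract m (fun j => X j.succ)

theorem iteratedContract_zero (X : Fin 0 → Module.Dual R M) (x : ExteriorAlgebra R M) :
    iteratedContract 0 X x = x := rfl

theorem iteratedContract_succ (m : ℕ) (X : Fin (m + 1) → Module.Dual R M)
    (x : ExteriorAlgebra R M) :
    iteratedContract (m + 1) X x =
      contractRight (Q := (0 : QuadraticForm R M)) (iteratedContract m (fun j => X j.succ) x)
        (X 0) := rfl

theorem iteratedContract_mul_ι (m : ℕ) (X : Fin (m + 1) → Module.Dual R M)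
    (x : ExteriorAlgebra R M) (θ : M) :
    iteratedContract (m + 1) X x * ι R θ =
      ∑ j : Fin (m + 1), ((-1) ^ (j : ℕ) * X j θ) • iteratedContract m (fun i => X (j.succAbove i)) x
        + (-1 : R) ^ (m + 1) • iteratedContract (m + 1) X (x * ι R θ) := by
  have key (d : Module.Dual R M) (y : ExteriorAlgebra R M) :
      contractRight (Q := (0 : QuadraticForm R M)) y d * ι R θ =
        d θ • y - contractRight (Q := (0 : QuadraticForm R M)) (y * ι R θ) d := by
    rw [eq_sub_iff_add_eq', ← eq_sub_iff_add_eq]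
    exact contractRight_mul_ι d θ y
  induction m with
  | zero => simp [iteratedContract_succ, iteratedContract_zero, key, sub_eq_add_neg]
  | succ m ih =>
    rw [iteratedContract_succ, key, ih]
    simp only [map_add, map_sum, map_smul, LinearMap.add_apply, LinearMap.sum_apply,
      LinearMap.smul_apply, ← iteratedContract_succ]
    have hs (j : Fin (m + 1)) :
        contractRight (Q := (0 : QuadraticForm R M))
          (iteratedContract m (fun i => X (j.succAbove i).succ) x) (X 0) =
        iteratedContract (m + 1) (fun i => X (j.succ.succAbove i)) x := by
      simp [iteratedContract_succ]
    simp only [hs]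
    rw [Fin.sum_univ_succ (n := m + 1)]
    simp only [Fin.val_zero, pow_zero, one_mul, Fin.zero_succAbove, Fin.val_succ, pow_succ,
      mul_neg, mul_one, neg_mul, neg_smul, Finset.sum_neg_distrib, neg_neg]
    rw [iteratedContract_succ (m + 1) X (x * ι R θ)]
    abel

theorem ιMulti_succ_last (p : ℕ) (θ : Fin (p + 1) → M) :
    ιMulti R (p + 1) θ = ιMulti R p (fun i => θ i.castSucc) * ι R (θ (Fin.last p)) := by
  rw [ιMulti_apply, ιMulti_apply, List.ofFn_succ', List.concat_eq_append, List.prod_append,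
    List.prod_singleton]

theorem iteratedContract_mul_ι_right (m : ℕ) (X : Fin (m + 1) → Module.Dual R M)
    (x : ExteriorAlgebra R M) (θ : M) :
    iteratedContract (m + 1) X (x * ι R θ) =
      (-1 : R) ^ (m + 1) • (iteratedContract (m + 1) X x * ι R θ) +
      ∑ j : Fin (m + 1),
        ((-1) ^ ((j : ℕ) + m) * X j θ) • iteratedContract m (fun i => X (j.succAbove i)) x := by
  have hsq : ((-1 : R) ^ (m + 1)) * (-1) ^ (m + 1) = 1 := by
    rw [← mul_pow]; simp
  rw [iteratedContract_mul_ι, smul_add, smul_smul, hsq, one_smul, Finset.smul_sum,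
    add_right_comm, ← Finset.sum_add_distrib, Finset.sum_eq_zero, zero_add]
  intro j _
  rw [smul_smul, ← add_smul]
  convert zero_smul R _ using 2
  ring

theorem iteratedContract_ιMulti_of_lt (p : ℕ) :
    ∀ (m : ℕ) (_ : p < m) (X : Fin m → Module.Dual R M) (θ : Fin p → M),
      iteratedContract m X (ιMulti R p θ) = 0 := by
  induction p with
  | zero =>
    intro m
    induction m with
    | zero => intro h; omega
    | succ m ih =>
      intro _ X θ
      rw [iteratedContract_succ]
      rcases Nat.eq_zero_or_pos m with rfl | hm
      · simp [iteratedContract_zero]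
      · rw [ih hm]; simp
  | succ p ih =>
    rintro (_ | m) h X θ
    · omega
    · rw [ιMulti_succ_last, iteratedContract_mul_ι_right, ih _ (by omega)]
      simp [ih m (by omega)]

theorem iteratedContract_ιMulti (m : ℕ) (X : Fin m → Module.Dual R M) (θ : Fin m → M) :
    iteratedContract m X (ιMulti R m θ) =
      algebraMap R (ExteriorAlgebra R M) (Matrix.of fun j i => X j (θ i)).det := by
  induction m with
  | zero => simp [iteratedContract_zero]
  | succ m ih =>
    rw [ιMulti_succ_last, iteratedContract_mul_ι_right,
      iteratedContract_ιMulti_of_lt m (m + 1) (by omega), Matrix.det_succ_column _ (Fin.last m)]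
    simp only [ih, zero_mul, smul_zero, zero_add, map_sum]
    refine Finset.sum_congr rfl fun j _ => ?_
    rw [Algebra.smul_def, ← map_mul]
    congr 2
    simp only [Fin.succAbove_last]
    rfl

theorem LinearMap.mem_smul_top {I : Ideal R} {N P : Type*} [AddCommGroup N] [Module R N]
    [AddCommGroup P] [Module R P] (φ : N →ₗ[R] P) {x : N}
    (hx : x ∈ I • (⊤ : Submodule R N)) : φ x ∈ I • (⊤ : Submodule R P) :=
  Submodule.smul_top_le_comap_smul_top I φ hx

theorem iteratedContract_mul_ιMulti_sub_mem (I : Ideal R) (x : ExteriorAlgebra R M) (m : ℕ)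
    (X : Fin m → Module.Dual R M) (θ : Fin m → M)
    (h : ∀ i, x * ι R (θ i) ∈ I • (⊤ : Submodule R (ExteriorAlgebra R M))) :
    iteratedContract m X x * ιMulti R m θ - (Matrix.of fun j i => X j (θ i)).det • x ∈
      I • (⊤ : Submodule R (ExteriorAlgebra R M)) := by
  induction m with
  | zero => simp [iteratedContract_zero]
  | succ m ih =>
    have hdet : (Matrix.of fun j i => X j (θ i)).det =
        ∑ j : Fin (m + 1), ((-1) ^ (j : ℕ) * X j (θ 0)) *
          (Matrix.of fun l i => X (j.succAbove l) (θ i.succ)).det :=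
      Matrix.det_succ_column_zero _
    rw [ιMulti_succ_apply, ← mul_assoc, iteratedContract_mul_ι, hdet, add_mul, Finset.sum_mul,
      Finset.sum_smul, add_sub_right_comm, ← Finset.sum_sub_distrib]
    refine add_mem (sum_mem fun j _ => ?_) ?_
    · rw [smul_mul_assoc, mul_smul _ _ x, ← smul_sub]
      exact Submodule.smul_mem _ _ (ih _ _ fun i => h i.succ)
    · rw [smul_mul_assoc]
      exact Submodule.smul_mem _ _ (LinearMap.mem_smul_top
        (LinearMap.mulRight R (ιMulti R m (Matrix.vecTail θ)) ∘ₗ iteratedContract (m + 1) X) (h 0))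

theorem ExteriorAlgebra.mem_smul_exteriorPower {I : Ideal R} {m : ℕ} {x : ExteriorAlgebra R M}
    (hx : x ∈ I • (⊤ : Submodule R (ExteriorAlgebra R M))) (hm : x ∈ ⋀[R]^m M) :
    x ∈ I • ⋀[R]^m M := by
  have hproj : GradedAlgebra.proj (fun i : ℕ => ⋀[R]^i M) m x = x :=
    DirectSum.decompose_of_mem_same (fun i : ℕ => ⋀[R]^i M) hm
  rw [← hproj]
  have h := Submodule.mem_map_of_mem (f := GradedAlgebra.proj (fun i : ℕ => ⋀[R]^i M) m) hx
  rw [Submodule.map_smul''] at h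
  refine Submodule.smul_mono le_rfl ?_ h
  rintro _ ⟨y, -, rfl⟩
  exact SetLike.coe_mem _

end Contraction

theorem det_indicator_of_strictMono {R : Type*} [CommRing R] {n k : ℕ} {J K : Fin k → Fin n}
    (hJ : StrictMono J) (hK : StrictMono K) :
    (Matrix.of fun j i => if J i = K j then (1 : R) else 0).det = if J = K then 1 else 0 := by
  split_ifs with h
  · subst h
    convert Matrix.det_one (n := Fin k) (R := R)
    ext i j
    simp [Matrix.one_apply, hJ.injective.eq_iff, eq_comm]
  · obtain ⟨s, hs⟩ : ∃ s, ∀ t, J t ≠ K s := by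
      by_contra! hc
      refine h ((hJ.range_inj hK).1 ?_)
      have hsub : Finset.univ.image K ⊆ Finset.univ.image J := by
        intro x
        simp only [Finset.mem_image, Finset.mem_univ, true_and]
        rintro ⟨s, rfl⟩
        exact hc s
      have heq := Finset.eq_of_subset_of_card_le hsub (by
        rw [Finset.card_image_of_injective _ hJ.injective,
          Finset.card_image_of_injective _ hK.injective])
      simpa using congrArg (fun s : Finset (Fin n) => (s : Set (Fin n))) heq.symm
    exact Matrix.det_eq_zero_of_row_eq_zero s fun t => by simp [hs t]

theorem stmt2 (n k : ℕ) (hk : 1 ≤ k) (hkn : k ≤ n)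
    (f : Fin k → MvPolynomial (Fin n) ℂ)
    (ω : ExteriorAlgebra (MvPolynomial (Fin n) ℂ) (Ω[MvPolynomial (Fin n) ℂ⁄ℂ]))
    (a : (Fin k → Fin n) → MvPolynomial (Fin n) ℂ)
    (hω : ω = ∑ J ∈ Finset.univ.filter (fun J : Fin k → Fin n => StrictMono J),
      a J • ιMulti (MvPolynomial (Fin n) ℂ) k (fun s => KaehlerDifferential.D ℂ (MvPolynomial (Fin n) ℂ) (MvPolynomial.X (J s))))
    (hinv : ∀ i : Fin k,
      ω * ι (MvPolynomial (Fin n) ℂ) (KaehlerDifferential.D ℂ (MvPolynomial (Fin n) ℂ) (f i)) ∈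
        (Ideal.span (Set.range f)) • (⋀[MvPolynomial (Fin n) ℂ]^(k+1) (Ω[MvPolynomial (Fin n) ℂ⁄ℂ])))
    (lam : (Fin k → Fin n) → MvPolynomial (Fin n) ℂ) :
    (∑ K ∈ Finset.univ.filter (fun K : Fin k → Fin n => StrictMono K), lam K * (Matrix.of fun r s : Fin k => MvPolynomial.pderiv (K s) (f r)).det) • ω - (∑ K ∈ Finset.univ.filter (fun K : Fin k → Fin n => StrictMono K), lam K * a K) • ιMulti (MvPolynomial (Fin n) ℂ) k (fun i => KaehlerDifferential.D ℂ (MvPolynomial (Fin n) ℂ) (f i)) ∈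
      (Ideal.span (Set.range f)) • (⋀[MvPolynomial (Fin n) ℂ]^k (Ω[MvPolynomial (Fin n) ℂ⁄ℂ])) := by
  let X : Fin n → Module.Dual (MvPolynomial (Fin n) ℂ)
      (Ω[MvPolynomial (Fin n) ℂ⁄ℂ]) := fun j =>
    (MvPolynomial.pderiv (R := ℂ) j).liftKaehlerDifferential
  have hXD (j : Fin n) (p : MvPolynomial (Fin n) ℂ) :
      X j (KaehlerDifferential.D ℂ (MvPolynomial (Fin n) ℂ) p) = MvPolynomial.pderiv j p :=
    Derivation.liftKaehlerDifferential_comp_D _ p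
  have hcoeff (K : Fin k → Fin n) (hK : StrictMono K) :
      iteratedContract k (fun s => X (K s)) ω = algebraMap (MvPolynomial (Fin n) ℂ) _ (a K) := by
    rw [hω, map_sum, Finset.sum_eq_single_of_mem K (by simpa using hK)]
    · rw [map_smul, iteratedContract_ιMulti]
      simp only [hXD, MvPolynomial.pderiv_X, Pi.single_apply, det_indicator_of_strictMono hK hK]
      simp [Algebra.smul_def]
    · intro J hJ hne
      rw [map_smul, iteratedContract_ιMulti]
      simp only [hXD, MvPolynomial.pderiv_X, Pi.single_apply,
        det_indicator_of_strictMono (Finset.mem_filter.1 hJ).2 hK]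
      simp [hne]
  have hωmem : ω ∈ ⋀[(MvPolynomial (Fin n) ℂ)]^k (Ω[MvPolynomial (Fin n) ℂ⁄ℂ]) := by
    rw [hω]
    exact sum_mem fun J _ => Submodule.smul_mem _ _ (ιMulti_range (MvPolynomial (Fin n) ℂ) k ⟨_, rfl⟩)
  refine mem_smul_exteriorPower ?_ (sub_mem (Submodule.smul_mem _ _ hωmem)
    (Submodule.smul_mem _ _ (ιMulti_range (MvPolynomial (Fin n) ℂ) k ⟨_, rfl⟩)))
  rw [Finset.sum_smul, Finset.sum_smul, ← Finset.sum_sub_distrib]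
  refine sum_mem fun K hK => ?_
  rw [mul_smul, mul_smul, ← smul_sub]
  refine Submodule.smul_mem _ _ ?_
  have h := iteratedContract_mul_ιMulti_sub_mem (Ideal.span (Set.range f)) ω k (fun s => X (K s))
    (fun i => KaehlerDifferential.D ℂ (MvPolynomial (Fin n) ℂ) (f i)) fun i =>
      Submodule.smul_mono le_rfl le_top (hinv i)
  rw [hcoeff K (Finset.mem_filter.1 hK).2, ← Algebra.smul_def] at h
  simp only [hXD] at h
  rw [← Matrix.det_transpose, ← neg_sub]
  exact neg_mem h
end

section
/- Let ω ∈ ⋀^k Ω satisfy the invariance condition ω ∧ df_i ∈ I·⋀^{k+1}Ω for every i = 1,…,k, and suppose that for some strictly increasing multi-index K of length k the image of Δ_K in R/I is not a zero divisor. If g, ξ, g′, ξ′ ∈ R satisfy the two decompositions g·ω − ξ·(df_1 ∧ ⋯ ∧ df_k) ∈ I·⋀^k Ω and g′·ω − ξ′·(df_1 ∧ ⋯ ∧ df_k) ∈ I·⋀^k Ω, then ξ·g′ − ξ′·g ∈ I. (This is the algebraic form of Aleksandrov's proposition that the multiple residue ξ/g restricted to V does not depend on the chosen decomposition, on which the well-definedness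 of the GSV-index rests.) -/
open ExteriorAlgebra

set_option synthInstance.maxHeartbeats 1000000
set_option maxHeartbeats 1000000

/-- The coefficient functional of `dx_{K 0} ∧ ⋯ ∧ dx_{K (k-1)}` on the exterior algebra of the Kähler
differentials of a polynomial ring. -/
noncomputable def coeffFunctional {A σ : Type*} [CommRing A] {k : ℕ} (K : Fin k → σ) :
    ExteriorAlgebra (MvPolynomial σ A) (Ω[MvPolynomial σ A⁄A]) →ₗ[MvPolynomial σ A]
      MvPolynomial σ A :=
  liftAlternating (Pi.single k (Matrix.detRowAlternating.compLinearMap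
    (LinearMap.pi fun s => (MvPolynomial.pderiv (K s)).liftKaehlerDifferential)))

theorem coeffFunctional_ιMulti_D {A σ : Type*} [CommRing A] {k : ℕ} (K : Fin k → σ)
    (f : Fin k → MvPolynomial σ A) :
    coeffFunctional K (ιMulti (MvPolynomial σ A) k
        (fun i => KaehlerDifferential.D A (MvPolynomial σ A) (f i))) =
      (Matrix.of fun r s : Fin k => MvPolynomial.pderiv (K s) (f r)).det := by
  rw [coeffFunctional, liftAlternating_apply_ιMulti, Pi.single_eq_same,
    AlternatingMap.compLinearMap_apply]
  change Matrix.det _ = _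
  congr 1 with r s
  simp

theorem LinearMap.apply_mem_of_mem_ideal_smul {R M : Type*} [CommRing R] [AddCommGroup M]
    [Module R M] (L : M →ₗ[R] R) {I : Ideal R} {N : Submodule R M} {x : M} (hx : x ∈ I • N) :
    L x ∈ I := by
  induction hx using Submodule.smul_induction_on' with
  | smul r hr m _ => simpa using I.mul_mem_right _ hr
  | add x _ y _ hx hy => simpa using I.add_mem hx hy

theorem stmt4 (n k : ℕ) (hk : 1 ≤ k) (hkn : k ≤ n)
    (f : Fin k → MvPolynomial (Fin n) ℂ)
    (ω : ExteriorAlgebra (MvPolynomial (Fin n) ℂ) (Ω[MvPolynomial (Fin n) ℂ⁄ℂ]))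
    (hωmem : ω ∈ ⋀[MvPolynomial (Fin n) ℂ]^k (Ω[MvPolynomial (Fin n) ℂ⁄ℂ]))
    (hinv : ∀ i : Fin k,
      ω * ι (MvPolynomial (Fin n) ℂ) (KaehlerDifferential.D ℂ (MvPolynomial (Fin n) ℂ) (f i)) ∈
        (Ideal.span (Set.range f)) • (⋀[MvPolynomial (Fin n) ℂ]^(k+1) (Ω[MvPolynomial (Fin n) ℂ⁄ℂ])))
    (K : Fin k → Fin n) (hK : StrictMono K)
    (hreg : Ideal.Quotient.mk (Ideal.span (Set.range f)) ((Matrix.of fun r s : Fin k => MvPolynomial.pderiv (K s) (f r)).det) ∈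
      nonZeroDivisors (MvPolynomial (Fin n) ℂ ⧸ Ideal.span (Set.range f)))
    (g ξ g' ξ' : MvPolynomial (Fin n) ℂ)
    (hdec : g • ω - ξ • ιMulti (MvPolynomial (Fin n) ℂ) k (fun i => KaehlerDifferential.D ℂ (MvPolynomial (Fin n) ℂ) (f i)) ∈ (Ideal.span (Set.range f)) • (⋀[MvPolynomial (Fin n) ℂ]^k (Ω[MvPolynomial (Fin n) ℂ⁄ℂ])))
    (hdec' : g' • ω - ξ' • ιMulti (MvPolynomial (Fin n) ℂ) k (fun i => KaehlerDifferential.D ℂ (MvPolynomial (Fin n) ℂ) (f i)) ∈ (Ideal.span (Set.range f)) • (⋀[MvPolynomial (Fin n) ℂ]^k (Ω[MvPolynomial (Fin n) ℂ⁄ℂ]))) :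
    ξ * g' - ξ' * g ∈ Ideal.span (Set.range f) := by
  set I := Ideal.span (Set.range f)
  have h := LinearMap.apply_mem_of_mem_ideal_smul (coeffFunctional K) hdec
  have h' := LinearMap.apply_mem_of_mem_ideal_smul (coeffFunctional K) hdec'
  rw [map_sub, map_smul, map_smul, coeffFunctional_ιMulti_D, smul_eq_mul, smul_eq_mul] at h h'
  rw [← Ideal.Quotient.eq_zero_iff_mem]
  refine (mem_nonZeroDivisors_iff_right.mp hreg) _ ?_
  rw [← map_mul, Ideal.Quotient.eq_zero_iff_mem]
  convert I.sub_mem (I.mul_mem_left g h') (I.mul_mem_left g' h) using 1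
  ring
end

section
/- Let f_0, f_1, …, f_k ∈ R be polynomials and c_0, c_1, …, c_k ∈ ℂ scalars, and define the k-form ω := Σ_{j=0}^{k} (−1)^j c_j f_j · df_0 ∧ ⋯ ∧ \widehat{df_j} ∧ ⋯ ∧ df_k ∈ ⋀^k Ω (the hat meaning that the factor df_j is omitted). Then for every i ∈ {0,1,…,k}, ω ∧ df_i = (−1)^k c_i f_i · df_0 ∧ df_1 ∧ ⋯ ∧ df_k. In particular, for each i ∈ {1,…,k} one has ω ∧ df_i ∈ (f_1,…,f_k)·⋀^{k+1}Ω, so the complete intersection V = {f_1 = ⋯ = f_k = 0} satisfies the invariance condition for the Pfaff system ω. (This is the sharp example showing that the bound d_1 + ⋯ + d_k ≤ d + k in the Poincaré problem for Pfaff systems is attained.) -/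
open ExteriorAlgebra

set_option synthInstance.maxHeartbeats 1000000
set_option maxHeartbeats 1000000

namespace ExteriorAlgebra

variable {R M : Type*} [CommRing R] [AddCommGroup M] [Module R M] {k : ℕ}

theorem ιMulti_mul_ι (v : Fin k → M) (x : M) :
    ιMulti R k v * ι R x = ιMulti R (k + 1) (Fin.snoc v x) := by
  simp only [ιMulti_apply]
  rw [List.ofFn_succ']
  simp

theorem ιMulti_removeNth_mul_ι_of_ne (v : Fin (k + 1) → M) {i j : Fin (k + 1)} (h : i ≠ j) :
    ιMulti R k (fun s => v (j.succAbove s)) * ι R (v i) = 0 := by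
  obtain ⟨s, rfl⟩ := Fin.exists_succAbove_eq h
  rw [ιMulti_mul_ι]
  exact (ιMulti R (k + 1)).map_eq_zero_of_eq (i := s.castSucc) (j := Fin.last k) _
    (by simp) (Fin.castSucc_lt_last s).ne

theorem neg_one_pow_smul_ιMulti_removeNth_mul_ι (v : Fin (k + 1) → M) (i : Fin (k + 1)) :
    (-1 : R) ^ (i : ℕ) • (ιMulti R k (fun s => v (i.succAbove s)) * ι R (v i)) =
      (-1 : R) ^ k • ιMulti R (k + 1) v := by
  have hlast := (ιMulti R (k + 1)).map_insertNth (Fin.last k) (v i) (i.removeNth v)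
  have hi := (ιMulti R (k + 1)).map_insertNth i (v i) (i.removeNth v)
  rw [Fin.insertNth_self_removeNth] at hi
  rw [Fin.insertNth_last'] at hlast
  have hmul := ιMulti_mul_ι (R := R) (i.removeNth v) (v i)
  rw [hlast] at hmul
  change (-1 : R) ^ (i : ℕ) • (ιMulti R k (i.removeNth v) * ι R (v i)) = _
  rw [hmul, hi, ← Int.cast_smul_eq_zsmul R, ← Int.cast_smul_eq_zsmul R, smul_smul, smul_smul,
    mul_comm]
  simp

end ExteriorAlgebra

theorem stmt9 (n k : ℕ)
    (f : Fin (k+1) → MvPolynomial (Fin (n+1)) ℂ) (c : Fin (k+1) → ℂ)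
    (ω : ExteriorAlgebra (MvPolynomial (Fin (n+1)) ℂ) (Ω[MvPolynomial (Fin (n+1)) ℂ⁄ℂ]))
    (hω : ω = ∑ j : Fin (k+1),
      ((-1 : MvPolynomial (Fin (n+1)) ℂ) ^ (j : ℕ) * MvPolynomial.C (c j) * f j) •
        ιMulti (MvPolynomial (Fin (n+1)) ℂ) k (fun s => KaehlerDifferential.D ℂ (MvPolynomial (Fin (n+1)) ℂ) (f (j.succAbove s)))) :
    (∀ i : Fin (k+1),
      ω * ι (MvPolynomial (Fin (n+1)) ℂ) (KaehlerDifferential.D ℂ (MvPolynomial (Fin (n+1)) ℂ) (f i)) =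
        ((-1 : MvPolynomial (Fin (n+1)) ℂ) ^ k * MvPolynomial.C (c i) * f i) •
          ιMulti (MvPolynomial (Fin (n+1)) ℂ) (k+1) (fun s => KaehlerDifferential.D ℂ (MvPolynomial (Fin (n+1)) ℂ) (f s))) ∧
    (∀ i : Fin k,
      ω * ι (MvPolynomial (Fin (n+1)) ℂ) (KaehlerDifferential.D ℂ (MvPolynomial (Fin (n+1)) ℂ) (f i.succ)) ∈
        (Ideal.span (Set.range fun r : Fin k => f r.succ)) •
          (⋀[MvPolynomial (Fin (n+1)) ℂ]^(k+1) (Ω[MvPolynomial (Fin (n+1)) ℂ⁄ℂ]))) := by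
  have key (i : Fin (k+1)) :
      ω * ι (MvPolynomial (Fin (n+1)) ℂ) (KaehlerDifferential.D ℂ (MvPolynomial (Fin (n+1)) ℂ) (f i)) =
        ((-1 : MvPolynomial (Fin (n+1)) ℂ) ^ k * MvPolynomial.C (c i) * f i) •
          ιMulti (MvPolynomial (Fin (n+1)) ℂ) (k+1) (fun s => KaehlerDifferential.D ℂ (MvPolynomial (Fin (n+1)) ℂ) (f s)) := by
    let v := fun s => KaehlerDifferential.D ℂ (MvPolynomial (Fin (n+1)) ℂ) (f s)
    rw [hω, Finset.sum_mul, Finset.sum_eq_single i]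
    · rw [smul_mul_assoc, mul_assoc, mul_comm, mul_smul,
        neg_one_pow_smul_ιMulti_removeNth_mul_ι v i, smul_smul]
      congr 1
      ring
    · intro j _ hj
      rw [smul_mul_assoc, ιMulti_removeNth_mul_ι_of_ne v hj.symm, smul_zero]
    · simp
  refine ⟨key, fun i => ?_⟩
  rw [key]
  exact Submodule.smul_mem_smul
    (Ideal.mul_mem_left _ _ (Ideal.subset_span (Set.mem_range_self i)))
    (ιMulti_range _ _ (Set.mem_range_self _))
end
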